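/- Let f ∈ Mould(m) and g ∈ Mould(n). Then τ(f ∘_1 g) = −(τ(g) ∘_n τ(f)) in Mould(m+n−1). -/

import Mathlib

/-!
Formalization of results from "The anticyclic operad of moulds" (F. Chapoton).

`Mould n` is the field of rational functions in variables `u 1, …, u n` with
rational coefficients, realized as a subfield of the fraction field `K` of
`ℚ[X 0, X 1, X 2, …]`.  The variable `u 0 = X 0` is reserved as an auxiliary
variable (the parameter `t` or `λ`).  Substitution of rational functions for
the variables is realized by the (partial, well-defined) function `msub`.
-/

noncomputable section
namespace MouldOperad

open MvPolynomial Finset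

attribute [local instance] Classical.propDecidable
set_option synthInstance.maxHeartbeats 1000000

abbrev MPoly : Type := MvPolynomial ℕ ℚ
abbrev K : Type := FractionRing MPoly

/-- the variable `u i` (1-based; index `0` is auxiliary). -/
def u (i : ℕ) : K := algebraMap MPoly K (X i)

/-- `u_{i..j} = u_i + u_{i+1} + ⋯ + u_j`. -/
def usum (i j : ℕ) : K := ∑ k ∈ Finset.Icc i j, u k

/-- evaluation of polynomials, sending the variable `X k` to `v k`. -/
def pev (v : ℕ → K) : MPoly →+* K :=
  eval₂Hom ((algebraMap MPoly K).comp (C : ℚ →+* MPoly)) v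

/-- Substitution of the rational functions `v k` for the variables of `f ∈ K`
(the induced field homomorphism): it takes the canonical value whenever `f` has
a fraction representation whose denominator does not vanish under the
substitution (this value does not depend on the representation), and the junk
value `0` otherwise. -/
def msub (v : ℕ → K) (f : K) : K :=
  if h : ∃ w : K, ∃ p q : MPoly, q ≠ 0 ∧
      f = algebraMap MPoly K p / algebraMap MPoly K q ∧
      pev v q ≠ 0 ∧ w = pev v p / pev v q
  then h.choose else 0

/-- the field `Mould n` of rational functions in `u 1, …, u n`. -/
def Mould (n : ℕ) : Subfield K :=
  Subfield.closure {x : K | ∃ i, 1 ≤ i ∧ i ≤ n ∧ x = u i}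

/-- substitution used for `f` in `f ∘_i g`, where `g` has degree `n`:
`f(u_1, …, u_{i-1}, u_{i..i+n-1}, u_{i+n}, …, u_{m+n-1})`. -/
def compSubF (n i : ℕ) : ℕ → K := fun k =>
  if k < i then u k else if k = i then usum i (i + n - 1) else u (k + n - 1)

/-- substitution used for `g` in `f ∘_i g` : `g(u_i, …, u_{i+n-1})`. -/
def compSubG (i : ℕ) : ℕ → K := fun k => u (k + i - 1)

/-- the composition `f ∘_i g`, where `g` has degree `n` (1-based index `i`). -/
def comp (n i : ℕ) (f g : K) : K :=
  usum i (i + n - 1) * msub (compSubF n i) f * msub (compSubG i) g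

/-- the push `τ` on `Mould n`: `τ(f)(u_1,…,u_n) = f(-u_{1..n}, u_1, …, u_{n-1})`. -/
def push (n : ℕ) (f : K) : K :=
  msub (fun k => if k = 1 then -(usum 1 n) else if k ≤ n then u (k - 1) else u k) f

/-- a permutation of `Fin n` as a (1-based) permutation of `ℕ`. -/
def permExt (n : ℕ) (σ : Equiv.Perm (Fin n)) : ℕ → ℕ := fun k =>
  if h : 1 ≤ k ∧ k ≤ n then ((σ ⟨k - 1, by omega⟩ : Fin n) : ℕ) + 1 else k

/-- `f ∈ Mould n` is alternal : for each `1 ≤ i ≤ n-1`, the sum of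
`f(u_{σ(1)}, …, u_{σ(n)})` over the shuffles `σ ∈ Sh(i, n-i)` vanishes. -/
def IsAlternal (n : ℕ) (f : K) : Prop :=
  ∀ i : ℕ, 1 ≤ i → i ≤ n - 1 →
    ∑ σ ∈ Finset.univ.filter (fun σ : Equiv.Perm (Fin n) =>
        (∀ a b : Fin n, a < b → (b : ℕ) < i → σ a < σ b) ∧
        (∀ a b : Fin n, a < b → i ≤ (a : ℕ) → σ a < σ b)),
      msub (fun k => u (permExt n σ k)) f = 0

/-- `f ∈ Mould n` is vegetal :
`u_1⋯u_n · Σ_{σ ∈ S_n} f(t·u_{σ(1)}, …, t·u_{σ(n)}) = n! · f(t,…,t)`,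
where the auxiliary variable `t` is `u 0`. -/
def IsVegetal (n : ℕ) (f : K) : Prop :=
  (∏ k ∈ Finset.Icc 1 n, u k) *
      ∑ σ : Equiv.Perm (Fin n), msub (fun k => u 0 * u (permExt n σ k)) f =
    (n.factorial : K) * msub (fun _ => u 0) f

/-- `f ∈ Mould n` is homogeneous of weight `d` : `f(λu_1,…,λu_n) = λ^d·f`,
where the auxiliary variable `λ` is `u 0`. -/
def IsHomogeneousOfWeight (n : ℕ) (d : ℤ) (f : K) : Prop :=
  msub (fun k => if 1 ≤ k ∧ k ≤ n then u 0 * u k else u k) f = u 0 ^ d * f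

/-- shift substitution : `g(u_{m+1}, …, u_{m+n})`. -/
def shiftSub (m : ℕ) : ℕ → K := fun k => u (k + m)

/-- `f ≻ g` for `f ∈ Mould m`, `g ∈ Mould n`. -/
def dsucc (m n : ℕ) (f g : K) : K :=
  f * msub (shiftSub m) g * usum (m + 1) (m + n) / usum 1 (m + n)

/-- `f ≺ g` for `f ∈ Mould m`, `g ∈ Mould n`. -/
def dprec (m n : ℕ) (f g : K) : K :=
  f * msub (shiftSub m) g * usum 1 m / usum 1 (m + n)

/-- `MU(f,g)` for `f ∈ Mould m`. -/
def MU (m : ℕ) (f g : K) : K := f * msub (shiftSub m) g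

/-- `LIMU(f,g) = MU(f,g) - MU(g,f)` for `f ∈ Mould m`, `g ∈ Mould n`. -/
def LIMU (m n : ℕ) (f g : K) : K := MU m f g - MU n g f

/-- the pre-Lie product `f ↶ g` for `f ∈ Mould m`, `g ∈ Mould n`. -/
def preLieCurve (m n : ℕ) (f g : K) : K :=
  f * msub (shiftSub m) g * usum (m + 1) (m + n) / usum 1 (m + n)
    - g * msub (shiftSub n) f * usum 1 n / usum 1 (m + n)

/-- the pre-Lie product `f ∘ g = Σ_{i=1}^m f ∘_i g`, `f ∈ Mould m`, `g ∈ Mould n`. -/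
def preLieComp (m n : ℕ) (f g : K) : K := ∑ i ∈ Finset.Icc 1 m, comp n i f g

/-- `H_n = ∏_{1 ≤ i ≤ j ≤ n} u_{i..j}`. -/
def Hprod (n : ℕ) : K := ∏ i ∈ Finset.Icc 1 n, ∏ j ∈ Finset.Icc i n, usum i j

/-- `x` is (the image of) a polynomial in `u_1, …, u_n`. -/
def IsPolyIn (n : ℕ) (x : K) : Prop :=
  ∃ p : MPoly, (∀ k ∈ p.vars, 1 ≤ k ∧ k ≤ n) ∧ x = algebraMap MPoly K p

/-- `f ∈ Mould n` has nice poles: it is a polynomial divided by a product of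
powers of the linear forms `u_{i..j}`, `1 ≤ i ≤ j ≤ n`. -/
def HasNicePoles (n : ℕ) (f : K) : Prop :=
  ∃ (P : MPoly) (e : ℕ → ℕ → ℕ),
    (∀ k ∈ P.vars, 1 ≤ k ∧ k ≤ n) ∧
    f = algebraMap MPoly K P /
        ∏ i ∈ Finset.Icc 1 n, ∏ j ∈ Finset.Icc i n, usum i j ^ e i j

/-- the Over product `f / Y`, `f ∈ Mould n`. -/
def overY (n : ℕ) (f : K) : K := f / usum 1 (n + 1)

/-- the Under product `Y \ f`, `f ∈ Mould n`. -/
def underY (n : ℕ) (f : K) : K := msub (fun k => u (k + 1)) f / usum 1 (n + 1)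

/-- `ARIT(f,g) = f ∘ (g/Y) - f ∘ (Y\g)` for `f ∈ Mould m`, `g ∈ Mould n`. -/
def ARIT (m n : ℕ) (f g : K) : K :=
  preLieComp m (n + 1) f (overY n g) - preLieComp m (n + 1) f (underY n g)

/-- `ARI(f,g) = ARIT(f,g) - ARIT(g,f) + LIMU(f,g)`, `f ∈ Mould m`, `g ∈ Mould n`. -/
def ARI (m n : ℕ) (f g : K) : K := ARIT m n f g - ARIT n m g f + LIMU m n f g

/-- evaluation of polynomials into `RatFunc K` (rational functions in `t` over `K`). -/
def pevR (v : ℕ → RatFunc K) : MPoly →+* RatFunc K :=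
  eval₂Hom ((RatFunc.C).comp ((algebraMap MPoly K).comp (C : ℚ →+* MPoly))) v

/-- substitution into `RatFunc K`. -/
def msubR (v : ℕ → RatFunc K) (f : K) : RatFunc K :=
  if h : ∃ w : RatFunc K, ∃ p q : MPoly, q ≠ 0 ∧
      f = algebraMap MPoly K p / algebraMap MPoly K q ∧
      pevR v q ≠ 0 ∧ w = pevR v p / pevR v q
  then h.choose else 0

/-- residue at `t = 0`: the coefficient of `t⁻¹` in the Laurent expansion at `0`. -/
def res (r : RatFunc K) : K := (↑r : LaurentSeries K).coeff (-1)

/-- the mould derivative `∂f` for `f ∈ Mould m`: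
`∂f(u_1,…,u_{m-1}) = Σ_{j=1}^m Res_{t=0} f(u_1,…,u_{j-1},t,u_j,…,u_{m-1})`,
where `f(u_1,…,u_{j-1},t,u_j,…,u_{m-1})` is viewed in `RatFunc K`. -/
def mderiv (m : ℕ) (f : K) : K :=
  ∑ j ∈ Finset.Icc 1 m,
    res (msubR (fun k =>
      if k < j then RatFunc.C (u k)
      else if k = j then RatFunc.X
      else RatFunc.C (u (k - 1))) f)

/-- evaluation of polynomials into `ℚ(x)`, sending every variable to `1/x`. -/
def pevX : MPoly →+* RatFunc ℚ :=
  eval₂Hom (RatFunc.C : ℚ →+* RatFunc ℚ) (fun _ => (RatFunc.X)⁻¹)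

/-- the substitution `u_i ↦ 1/x`, landing in `ℚ(x)`. -/
def evalx (f : K) : RatFunc ℚ :=
  if h : ∃ w : RatFunc ℚ, ∃ p q : MPoly, q ≠ 0 ∧
      f = algebraMap MPoly K p / algebraMap MPoly K q ∧
      pevX q ≠ 0 ∧ w = pevX p / pevX q
  then h.choose else 0

/-- the derivative `d/dx` on `ℚ(x)`. -/
def rfDeriv (r : RatFunc ℚ) : RatFunc ℚ :=
  (algebraMap (Polynomial ℚ) (RatFunc ℚ) (Polynomial.derivative r.num) *
      algebraMap (Polynomial ℚ) (RatFunc ℚ) r.denom -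
    algebraMap (Polynomial ℚ) (RatFunc ℚ) r.num *
      algebraMap (Polynomial ℚ) (RatFunc ℚ) (Polynomial.derivative r.denom)) /
    algebraMap (Polynomial ℚ) (RatFunc ℚ) r.denom ^ 2

theorem usum_add (i d : ℕ) : usum i (i + d) = ∑ j ∈ range (d + 1), u (i + j) := by
  rw [usum, ← Ico_add_one_right_eq_Icc, sum_Ico_eq_sum_range]
  congr 2
  omega

theorem pev_injective_of_leftInverse {v : ℕ → K} (v' w : ℕ → MPoly)
    (hv : ∀ k, v k = algebraMap MPoly K (v' k))
    (hw : ∀ k, aeval (R := ℚ) w (v' k) = X k) : Function.Injective (pev v) := by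
  have hpev : pev v = (algebraMap MPoly K).comp (aeval (R := ℚ) v' : MPoly →ₐ[ℚ] MPoly) := by
    apply MvPolynomial.ringHom_ext
    · intro r
      simp only [pev, coe_eval₂Hom, eval₂_C, RingHom.comp_apply, RingHom.coe_coe, algHom_C,
        algebraMap_eq]
    · intro k
      simp [pev, hv]
  have hleft : ∀ p : MPoly, aeval (R := ℚ) w (aeval (R := ℚ) v' p) = p := by
    intro p
    have hcomp : (aeval (R := ℚ) w : MPoly →ₐ[ℚ] MPoly).comp (aeval (R := ℚ) v') =
        AlgHom.id ℚ MPoly := by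
      apply MvPolynomial.algHom_ext
      intro k
      rw [AlgHom.comp_apply, aeval_X, hw, AlgHom.id_apply]
    exact DFunLike.congr_fun hcomp p
  rw [hpev]
  exact (IsFractionRing.injective MPoly K).comp (Function.LeftInverse.injective hleft)

theorem msub_eq_lift {v : ℕ → K} (hv : Function.Injective (pev v)) (x : K) :
    msub v x = IsFractionRing.lift hv x := by
  have hne : ∀ q : MPoly, q ≠ 0 → pev v q ≠ 0 := fun q hq => (map_ne_zero_iff _ hv).2 hq
  have hex : ∃ w : K, ∃ p q : MPoly, q ≠ 0 ∧
      x = algebraMap MPoly K p / algebraMap MPoly K q ∧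
      pev v q ≠ 0 ∧ w = pev v p / pev v q := by
    obtain ⟨p, q, hq, rfl⟩ := IsFractionRing.div_surjective (A := MPoly) x
    have hq0 := nonZeroDivisors.ne_zero hq
    exact ⟨_, p, q, hq0, rfl, hne q hq0, rfl⟩
  rw [msub, dif_pos hex]
  obtain ⟨p, q, -, hx, -, hw⟩ := hex.choose_spec
  rw [hw, hx, map_div₀, IsFractionRing.lift_algebraMap, IsFractionRing.lift_algebraMap]

/-- A substitution by polynomials admitting a polynomial left inverse is a field homomorphism. -/
theorem exists_ringHom_eq_msub {v : ℕ → K} (v' w : ℕ → MPoly)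
    (hv : ∀ k, v k = algebraMap MPoly K (v' k))
    (hw : ∀ k, aeval (R := ℚ) w (v' k) = X k) :
    ∃ φ : K →+* K, (∀ x, msub v x = φ x) ∧ ∀ k, φ (u k) = v k := by
  have hinj := pev_injective_of_leftInverse v' w hv hw
  refine ⟨IsFractionRing.lift hinj, msub_eq_lift hinj, fun k => ?_⟩
  rw [u, IsFractionRing.lift_algebraMap]
  simp [pev]

theorem exists_ringHom_compSubF (d i : ℕ) :
    ∃ φ : K →+* K, (∀ x, msub (compSubF (d + 1) i) x = φ x) ∧
      ∀ k, φ (u k) = compSubF (d + 1) i k := by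
  refine exists_ringHom_eq_msub
    (fun k => if k < i then X k else if k = i then ∑ j ∈ range (d + 1), X (i + j) else X (k + d))
    (fun k => if k ≤ i then X k else if k ≤ i + d then 0 else X (k - d)) ?_ ?_
  · intro k
    rw [compSubF, ← add_assoc, Nat.add_sub_cancel, usum_add, ← add_assoc, Nat.add_sub_cancel]
    split_ifs <;> simp [u]
  · intro k
    rcases lt_trichotomy k i with h | rfl | h
    · simp [h, h.le]
    · have hz : ∀ j ∈ range d, (if k + (j + 1) ≤ k then (X (k + (j + 1)) : MPoly)
          else if k + (j + 1) ≤ k + d then 0 else X (k + (j + 1) - d)) = 0 := by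
        intro j hj
        have := mem_range.1 hj
        rw [if_neg (by omega), if_pos (by omega)]
      simp only [lt_irrefl, if_false, if_true, map_sum, aeval_X]
      rw [sum_range_succ', sum_eq_zero hz]
      simp
    · have h1 : ¬ k < i := by omega
      have h2 : ¬ k = i := by omega
      have h3 : ¬ k + d ≤ i := by omega
      have h4 : ¬ k ≤ i := by omega
      simp [h1, h2, h3, h4]

theorem exists_ringHom_compSubG (d : ℕ) :
    ∃ φ : K →+* K, (∀ x, msub (compSubG (d + 1)) x = φ x) ∧ ∀ k, φ (u k) = u (k + d) := by
  refine exists_ringHom_eq_msub (v := compSubG (d + 1)) (fun k => X (k + d))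
    (fun k => X (k - d)) ?_ ?_
  · intro k
    rfl
  · intro k
    simp

theorem exists_ringHom_push (d : ℕ) :
    ∃ φ : K →+* K, (∀ x, push (d + 1) x = φ x) ∧
      φ (u 1) = -∑ j ∈ range (d + 1), u (1 + j) ∧ ∀ k < d, φ (u (1 + (k + 1))) = u (1 + k) := by
  suffices h : ∃ φ : K →+* K, (∀ x, push (d + 1) x = φ x) ∧ ∀ k, φ (u k) =
      if k = 1 then -(usum 1 (d + 1)) else if k ≤ d + 1 then u (k - 1) else u k by
    obtain ⟨φ, hφ, hu⟩ := h
    refine ⟨φ, hφ, ?_, fun k hk => ?_⟩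
    · rw [hu, if_pos rfl, add_comm d 1, usum_add, add_comm 1 d]
    · rw [hu, if_neg (by omega), if_pos (by omega)]
      congr 1
  refine exists_ringHom_eq_msub
    (v := fun k => if k = 1 then -(usum 1 (d + 1)) else if k ≤ d + 1 then u (k - 1) else u k)
    (fun k => if k = 1 then -∑ j ∈ range (d + 1), X (1 + j)
      else if k ≤ d + 1 then X (k - 1) else X k)
    (fun k => if k = 0 then X 0 else if k ≤ d then X (k + 1)
      else if k = d + 1 then -X 1 - ∑ j ∈ range d, X (j + 2) else X k) ?_ ?_
  · intro k
    rw [add_comm d 1, usum_add, add_comm 1 d]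
    split_ifs <;> simp [u]
  · intro k
    by_cases h1 : k = 1
    · subst h1
      simp only [if_true, map_neg, map_sum, aeval_X]
      rw [sum_range_succ, sum_congr rfl (g := fun j => (X (j + 2) : MPoly))]
      · rw [if_neg (by omega), if_neg (by omega), if_pos (by omega)]
        ring
      · intro j hj
        have := mem_range.1 hj
        rw [if_neg (by omega), if_pos (by omega)]
        congr 1
        omega
    · by_cases h2 : k ≤ d + 1
      · rcases Nat.eq_zero_or_pos k with rfl | h0
        · simp
        · have h3 : ¬ k - 1 = 0 := by omega
          have h4 : k - 1 ≤ d := by omega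
          have h5 : k - 1 + 1 = k := by omega
          simp only [h1, h2, if_false, if_true, aeval_X, h3, h4, h5]
      · have h3 : ¬ k = 0 := by omega
        have h4 : ¬ k ≤ d := by omega
        have h5 : ¬ k = d + 1 := by omega
        simp only [h1, h2, if_false, aeval_X, h3, h4, h5]

theorem eq_of_mem_Mould {d : ℕ} {φ ψ : K →+* K} (h1 : φ (u 1) = ψ (u 1))
    (h : ∀ k < d, φ (u (1 + (k + 1))) = ψ (u (1 + (k + 1)))) {x : K} (hx : x ∈ Mould (d + 1)) :
    φ x = ψ x := by
  refine RingHom.eqOn_field_closure ?_ hx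
  rintro _ ⟨i, hi, hid, rfl⟩
  obtain ⟨_ | k, rfl⟩ := Nat.exists_eq_add_of_le hi
  · exact h1
  · exact h k (by omega)

/-- for `f ∈ Mould m` and `g ∈ Mould n`, one has
`τ(f ∘_1 g) = -(τ(g) ∘_n τ(f))` in `Mould (m+n-1)`. -/
theorem push_comp_one (m n : ℕ) (hm : 1 ≤ m) (hn : 1 ≤ n)
    (f g : K) (hf : f ∈ Mould m) (hg : g ∈ Mould n) :
    push (m + n - 1) (comp n 1 f g) = -(comp m n (push n g) (push m f)) := by
  obtain ⟨a, rfl⟩ : ∃ a, m = a + 1 := ⟨m - 1, by omega⟩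
  obtain ⟨b, rfl⟩ : ∃ b, n = b + 1 := ⟨n - 1, by omega⟩
  have hab : a + 1 + (b + 1) - 1 = b + a + 1 := by omega
  obtain ⟨P, hP, hP1, hPs⟩ := exists_ringHom_push (b + a)
  obtain ⟨Pf, hPf, hPf1, hPfs⟩ := exists_ringHom_push a
  obtain ⟨Pg, hPg, hPg1, hPgs⟩ := exists_ringHom_push b
  obtain ⟨F, hF, hFu⟩ := exists_ringHom_compSubF b 1
  obtain ⟨F', hF', hFu'⟩ := exists_ringHom_compSubF a (b + 1)
  obtain ⟨G, hG, hGu⟩ := exists_ringHom_compSubG 0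
  obtain ⟨G', hG', hGu'⟩ := exists_ringHom_compSubG b
  have hF1 : F (u 1) = ∑ j ∈ range (b + 1), u (1 + j) := by
    rw [hFu, ← usum_add]
    rfl
  have hFs : ∀ k, F (u (1 + (k + 1))) = u (1 + (b + k + 1)) := by
    intro k
    rw [hFu, compSubF, if_neg (by omega), if_neg (by omega)]
    congr 1
    omega
  have hFlt' : ∀ k < b, F' (u (1 + k)) = u (1 + k) := by
    intro k hk
    rw [hFu', compSubF, if_pos (by omega)]
  have hFtop' : F' (u (1 + b)) = ∑ j ∈ range (a + 1), u (1 + (b + j)) := by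
    rw [hFu', compSubF, if_neg (by omega), if_pos (by omega), ← add_assoc, Nat.add_sub_cancel,
      usum_add]
    refine sum_congr rfl fun j _ => ?_
    congr 1
    omega
  have hsplit : ∑ j ∈ range (b + a + 1), u (1 + j) =
      ∑ j ∈ range b, u (1 + j) + ∑ j ∈ range (a + 1), u (1 + (b + j)) := by
    rw [add_assoc, sum_range_add]
  have hPsum : P (∑ j ∈ range (b + 1), u (1 + j)) =
      -∑ j ∈ range (a + 1), u (1 + (b + j)) := by
    rw [sum_range_succ', map_add, map_sum,
      sum_congr rfl fun j hj => hPs j (by have := mem_range.1 hj; omega), add_zero, hP1, hsplit]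
    ring
  have hf' : P (F f) = G' (Pf f) := by
    refine eq_of_mem_Mould (φ := P.comp F) (ψ := G'.comp Pf) ?_ (fun k hk => ?_) hf
    · simp only [RingHom.comp_apply]
      rw [hF1, hPsum, hPf1, map_neg, map_sum]
      refine congrArg _ (sum_congr rfl fun j _ => ?_)
      rw [hGu']
      congr 1
      omega
    · simp only [RingHom.comp_apply]
      rw [hFs, hPs _ (by omega), hPfs k hk, hGu']
      congr 1
      omega
  have hg' : P (G g) = F' (Pg g) := by
    refine eq_of_mem_Mould (φ := P.comp G) (ψ := F'.comp Pg) ?_ (fun k hk => ?_) hg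
    · simp only [RingHom.comp_apply]
      rw [hGu, hP1, hPg1, map_neg, map_sum, sum_range_succ (fun j => F' (u (1 + j))) b, hFtop', hsplit,
        sum_congr rfl fun j hj => hFlt' j (mem_range.1 hj)]
    · simp only [RingHom.comp_apply]
      rw [hGu, add_zero, hPs k (by omega), hPgs k hk, hFlt' k hk]
  have hsum1 : usum 1 (1 + (b + 1) - 1) = ∑ j ∈ range (b + 1), u (1 + j) := by
    rw [← usum_add]
    rfl
  have hsum2 : usum (b + 1) (b + 1 + (a + 1) - 1) = ∑ j ∈ range (a + 1), u (1 + (b + j)) := by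
    rw [← hFtop', hFu', compSubF, if_neg (by omega), if_pos (by omega)]
  rw [hab, hP, comp, comp, hsum1, hsum2, hF, hG, hF', hG', hPf, hPg, map_mul, map_mul, hPsum,
    hf', hg']
  ring

end MouldOperad
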